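/- Let n ≥ 1, k ≥ 1 and let a1 = a2 = a ≥ 1 be an integer. Then there exists a constant C > 0 (depending on n, k, a) such that for all sufficiently large positive integers m, both the kernel and the cokernel of the linear map D^k : V_{m·a−k, m·a+k−(n+1)} → V_{m·a, m·a−(n+1)} have ℂ-dimension at most C·m^{2n−2}. -/

import Mathlib

open MvPolynomial

/-- The space of bihomogeneous polynomials of bidegree `(a, b)` in the two groups of
variables `x_0, …, x_n` (indexed by `Sum.inl`) and `y_0, …, y_n` (indexed by `Sum.inr`). -/
noncomputable def Vab (n a b : ℕ) :
    Submodule ℂ (MvPolynomial (Fin (n + 1) ⊕ Fin (n + 1)) ℂ) :=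
  weightedHomogeneousSubmodule ℂ
    (Sum.elim (fun _ => ((1 : ℕ), (0 : ℕ))) (fun _ => ((0 : ℕ), (1 : ℕ)))) (a, b)

/-- The operator `D = ∑ i, x_i · ∂/∂y_i`. -/
noncomputable def Dop (n : ℕ) :
    Module.End ℂ (MvPolynomial (Fin (n + 1) ⊕ Fin (n + 1)) ℂ) :=
  ∑ i : Fin (n + 1),
    (LinearMap.mulLeft ℂ (X (Sum.inl i))).comp (pderiv (Sum.inr i)).toLinearMap

section abstractSl2

variable {W : Type*} [AddCommGroup W] [Module ℂ W]

theorem sl2_H_pow (D H : Module.End ℂ W) (h2 : ∀ v, H (D v) = D (H v) + (2 : ℂ) • D v)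
    (c : ℂ) (u : W) (hu : H u = c • u) (j : ℕ) :
    H ((D ^ j) u) = (c + 2 * j) • (D ^ j) u := by
  induction j with
  | zero => simp [hu]
  | succ j ih =>
    rw [pow_succ', Module.End.mul_apply, h2, ih, map_smul, ← add_smul]
    congr 1
    push_cast
    ring

theorem sl2_comm (D E H : Module.End ℂ W) (h1 : ∀ v, D (E v) = E (D v) + H v)
    (h2 : ∀ v, H (D v) = D (H v) + (2 : ℂ) • D v)
    (c : ℂ) (u : W) (hu : H u = c • u) (j : ℕ) :
    (D ^ (j + 1)) (E u) = E ((D ^ (j + 1)) u) + ((j + 1) * (c + j)) • (D ^ j) u := by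
  induction j with
  | zero => simp [h1, hu]
  | succ j ih =>
    rw [pow_succ', Module.End.mul_apply, ih, map_add, h1, sl2_H_pow D H h2 c u hu, map_smul,
      ← Module.End.mul_apply D, ← pow_succ' D, ← Module.End.mul_apply D, ← pow_succ' D, add_assoc,
      ← add_smul]
    congr 2
    push_cast
    ring

theorem sl2_surj (D E H : Module.End ℂ W) (h1 : ∀ v, D (E v) = E (D v) + H v)
    (h2 : ∀ v, H (D v) = D (H v) + (2 : ℂ) • D v)
    (c : ℕ) (A B : Submodule ℂ W) (hA : ∀ u ∈ A, H u = ((c + 1 : ℕ) : ℂ) • u)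
    (hE : ∀ u ∈ A, E u ∈ B) (hD : ∀ v ∈ B, D v ∈ A) (j : ℕ) :
    ∀ u ∈ A, (D ^ j) u = 0 → ∃ v ∈ B, D v = u := by
  induction j with
  | zero =>
    intro u _ h
    exact ⟨0, B.zero_mem, by simpa using h.symm⟩
  | succ j ih =>
    intro u hu h
    have key := sl2_comm D E H h1 h2 _ u (hA u hu) j
    rw [h, map_zero, zero_add] at key
    set z : ℂ := ((j + 1) * (((c + 1 : ℕ) : ℂ) + j)) with hz
    have hz0 : z ≠ 0 := by
      have : z = (((j + 1) * ((c + 1) + j) : ℕ) : ℂ) := by rw [hz]; push_cast; ring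
      rw [this]
      exact_mod_cast (by positivity)
    obtain ⟨v, hv, hv'⟩ := ih (u - z⁻¹ • D (E u))
      (A.sub_mem hu (A.smul_mem _ (hD _ (hE _ hu)))) (by
        rw [map_sub, map_smul, ← Module.End.mul_apply, ← pow_succ, key, smul_smul,
          inv_mul_cancel₀ hz0, one_smul, sub_self])
    refine ⟨v + z⁻¹ • E u, B.add_mem hv (B.smul_mem _ (hE _ hu)), ?_⟩
    rw [map_add, hv', map_smul, sub_add_cancel]

theorem sl2_inj (D E H : Module.End ℂ W) (h1 : ∀ v, D (E v) = E (D v) + H v)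
    (h2 : ∀ v, H (D v) = D (H v) + (2 : ℂ) • D v)
    (c : ℕ) (u : W) (hu : H u = ((c + 1 : ℕ) : ℂ) • u) (hE : E u = 0) (j : ℕ)
    (hj : (D ^ j) u = 0) : u = 0 := by
  induction j with
  | zero => simpa using hj
  | succ j ih =>
    apply ih
    have key := sl2_comm D E H h1 h2 _ u hu j
    rw [hE, hj, map_zero, map_zero, zero_add] at key
    refine (smul_eq_zero.mp key.symm).resolve_left ?_
    have : ((j + 1) * (((c + 1 : ℕ) : ℂ) + j)) = (((j + 1) * ((c + 1) + j) : ℕ) : ℂ) := by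
      push_cast; ring
    rw [this]
    exact_mod_cast (by positivity)

end abstractSl2

/-- `D` as a derivation. -/
noncomputable def dD (n : ℕ) : Derivation ℂ (MvPolynomial (Fin (n + 1) ⊕ Fin (n + 1)) ℂ)
    (MvPolynomial (Fin (n + 1) ⊕ Fin (n + 1)) ℂ) :=
  ∑ i : Fin (n + 1), (X (Sum.inl i) : MvPolynomial (Fin (n + 1) ⊕ Fin (n + 1)) ℂ) •
    pderiv (Sum.inr i)

/-- `E = ∑ y_i ∂/∂x_i`. -/
noncomputable def dE (n : ℕ) : Derivation ℂ (MvPolynomial (Fin (n + 1) ⊕ Fin (n + 1)) ℂ)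
    (MvPolynomial (Fin (n + 1) ⊕ Fin (n + 1)) ℂ) :=
  ∑ i : Fin (n + 1), (X (Sum.inr i) : MvPolynomial (Fin (n + 1) ⊕ Fin (n + 1)) ℂ) •
    pderiv (Sum.inl i)

/-- `H = deg_x - deg_y`. -/
noncomputable def dH (n : ℕ) : Derivation ℂ (MvPolynomial (Fin (n + 1) ⊕ Fin (n + 1)) ℂ)
    (MvPolynomial (Fin (n + 1) ⊕ Fin (n + 1)) ℂ) :=
  ∑ i : Fin (n + 1), (X (Sum.inl i) : MvPolynomial (Fin (n + 1) ⊕ Fin (n + 1)) ℂ) •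
    pderiv (Sum.inl i) -
  ∑ i : Fin (n + 1), (X (Sum.inr i) : MvPolynomial (Fin (n + 1) ⊕ Fin (n + 1)) ℂ) •
    pderiv (Sum.inr i)

theorem deriv_sum_apply {R : Type*} [CommRing R] [Algebra ℂ R] {ι : Type*} (s : Finset ι)
    (d : ι → Derivation ℂ R R) (f : R) : (∑ i ∈ s, d i) f = ∑ i ∈ s, d i f := by
  have h := map_sum (Derivation.coeFnAddMonoidHom (R := ℂ) (A := R) (M := R)) d s
  have h2 := congrFun h f
  rw [Finset.sum_apply] at h2
  exact h2

theorem dD_apply (n : ℕ) (f) : dD n f = ∑ i, X (Sum.inl i) * pderiv (Sum.inr i) f := by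
  simp [dD, deriv_sum_apply]

theorem dE_apply (n : ℕ) (f) : dE n f = ∑ i, X (Sum.inr i) * pderiv (Sum.inl i) f := by
  simp [dE, deriv_sum_apply]

theorem dH_apply (n : ℕ) (f) : dH n f = ∑ i, X (Sum.inl i) * pderiv (Sum.inl i) f -
    ∑ i, X (Sum.inr i) * pderiv (Sum.inr i) f := by
  simp [dH, deriv_sum_apply]

theorem Dop_eq (n : ℕ) (f) : Dop n f = dD n f := by
  simp [dD_apply, Dop]

theorem dD_inl (n : ℕ) (i) : dD n (X (Sum.inl i)) = 0 := by
  simp [dD_apply, pderiv_X, Pi.single_apply]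
theorem dD_inr (n : ℕ) (i) : dD n (X (Sum.inr i)) = X (Sum.inl i) := by
  simp [dD_apply, pderiv_X, Pi.single_apply]
theorem dE_inr (n : ℕ) (i) : dE n (X (Sum.inr i)) = 0 := by
  simp [dE_apply, pderiv_X, Pi.single_apply]
theorem dE_inl (n : ℕ) (i) : dE n (X (Sum.inl i)) = X (Sum.inr i) := by
  simp [dE_apply, pderiv_X, Pi.single_apply]
theorem dH_inl (n : ℕ) (i) : dH n (X (Sum.inl i)) = X (Sum.inl i) := by
  simp [dH_apply, pderiv_X, Pi.single_apply]
theorem dH_inr (n : ℕ) (i) : dH n (X (Sum.inr i)) = - X (Sum.inr i) := by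
  simp [dH_apply, pderiv_X, Pi.single_apply]

theorem lie_DE (n : ℕ) : ⁅dD n, dE n⁆ = dH n := by
  apply derivation_ext
  rintro (i | i) <;>
    simp [Derivation.commutator_apply, dD_inl, dD_inr, dE_inl, dE_inr, dH_inl, dH_inr]

theorem lie_HD (n : ℕ) : ⁅dH n, dD n⁆ = (2 : ℂ) • dD n := by
  apply derivation_ext
  rintro (i | i) <;>
    simp [Derivation.commutator_apply, dD_inl, dD_inr, dE_inl, dE_inr, dH_inl, dH_inr, two_smul]

theorem lie_HE (n : ℕ) : ⁅dH n, dE n⁆ = -((2 : ℂ) • dE n) := by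
  apply derivation_ext
  rintro (i | i) <;>
    simp [Derivation.commutator_apply, dD_inl, dD_inr, dE_inl, dE_inr, dH_inl, dH_inr, two_smul]
  ring

theorem DE_comm (n : ℕ) (f) : dD n (dE n f) = dE n (dD n f) + dH n f := by
  rw [← lie_DE, Derivation.commutator_apply]; ring

theorem HD_comm (n : ℕ) (f) : dH n (dD n f) = dD n (dH n f) + (2 : ℂ) • dD n f := by
  rw [← Derivation.smul_apply, ← lie_HD, Derivation.commutator_apply]; ring

theorem HE_comm (n : ℕ) (f) : dH n (dE n f) = dE n (dH n f) - (2 : ℂ) • dE n f := by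
  have := congrArg (fun d => d f) (lie_HE n)
  simp only [Derivation.commutator_apply, Derivation.neg_apply, Derivation.smul_apply] at this
  rw [sub_eq_iff_eq_add] at this
  rw [this]; ring

/-- The weights. -/
abbrev wt (n : ℕ) : Fin (n + 1) ⊕ Fin (n + 1) → ℕ × ℕ :=
  (Sum.elim (fun _ => ((1 : ℕ), (0 : ℕ))) (fun _ => ((0 : ℕ), (1 : ℕ))))

theorem weight_wt (n : ℕ) (d : Fin (n + 1) ⊕ Fin (n + 1) →₀ ℕ) :
    Finsupp.weight (wt n) d = (∑ i, d (Sum.inl i), ∑ i, d (Sum.inr i)) := by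
  rw [Finsupp.weight_apply, Finsupp.sum_fintype _ _ (by simp)]
  ext <;> simp [Prod.fst_sum, Prod.snd_sum, Fintype.sum_sum_type]

theorem mem_Vab_iff (n a b : ℕ) (f) : f ∈ Vab n a b ↔ IsWeightedHomogeneous (wt n) f (a, b) :=
  Iff.rfl

theorem Vab_ext (n a b : ℕ) (S T : Module.End ℂ (MvPolynomial (Fin (n + 1) ⊕ Fin (n + 1)) ℂ))
    (h : ∀ d : Fin (n + 1) ⊕ Fin (n + 1) →₀ ℕ, ∑ i, d (Sum.inl i) = a → ∑ i, d (Sum.inr i) = b →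
      ∀ c, S (monomial d c) = T (monomial d c)) (f) (hf : f ∈ Vab n a b) : S f = T f := by
  rw [f.as_sum, map_sum, map_sum]
  refine Finset.sum_congr rfl fun d hd => ?_
  have h3 := (mem_Vab_iff n a b f).1 hf (mem_support_iff.1 hd)
  rw [weight_wt] at h3
  simp only [Prod.mk.injEq] at h3
  exact h d h3.1 h3.2 _

theorem dH_Vab (n a b : ℕ) (f) (hf : f ∈ Vab n a b) : dH n f = ((a : ℂ) - b) • f := by
  refine Vab_ext n a b (dH n).toLinearMap (((a : ℂ) - b) • LinearMap.id) ?_ f hf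
  intro d h1 h2 c
  change dH n _ = _
  simp only [dH_apply,
    X_mul_pderiv_monomial, LinearMap.smul_apply, LinearMap.id_apply]
  rw [← Finset.sum_smul, ← Finset.sum_smul, h1, h2, sub_smul, Nat.cast_smul_eq_nsmul,
    Nat.cast_smul_eq_nsmul]

theorem dD_Vab_zero (n a : ℕ) (f) (hf : f ∈ Vab n a 0) : dD n f = 0 := by
  refine Vab_ext n a 0 (dD n).toLinearMap 0 ?_ f hf
  intro d h1 h2 c
  have : ∀ i, d (Sum.inr i) = 0 := by simpa using h2
  simp [dD_apply, pderiv_monomial, this]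

theorem dE_Vab_zero (n b : ℕ) (f) (hf : f ∈ Vab n 0 b) : dE n f = 0 := by
  refine Vab_ext n 0 b (dE n).toLinearMap 0 ?_ f hf
  intro d h1 h2 c
  have : ∀ i, d (Sum.inl i) = 0 := by simpa using h1
  simp [dE_apply, pderiv_monomial, this]

theorem dD_mem (n a b : ℕ) (f) (hf : f ∈ Vab n a (b + 1)) : dD n f ∈ Vab n (a + 1) b := by
  rw [dD_apply]
  refine Submodule.sum_mem _ fun i _ => ?_
  rw [mem_Vab_iff] at *
  have h1 := hf.pderiv (i := Sum.inr i) (n' := (a, b)) (by simp)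
  have h2 := (isWeightedHomogeneous_X ℂ (wt n) (Sum.inl i)).mul h1
  convert h2 using 1
  simp [add_comm]

theorem dE_mem (n a b : ℕ) (f) (hf : f ∈ Vab n (a + 1) b) : dE n f ∈ Vab n a (b + 1) := by
  rw [dE_apply]
  refine Submodule.sum_mem _ fun i _ => ?_
  rw [mem_Vab_iff] at *
  have h1 := hf.pderiv (i := Sum.inl i) (n' := (a, b)) (by simp)
  have h2 := (isWeightedHomogeneous_X ℂ (wt n) (Sum.inr i)).mul h1
  convert h2 using 1
  simp [add_comm]

theorem dD_nil (n b : ℕ) : ∀ (a : ℕ) (f) (_ : f ∈ Vab n a b),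
    (((dD n).toLinearMap : Module.End ℂ _) ^ (b + 1)) f = 0 := by
  induction b with
  | zero => intro a f hf; simpa using dD_Vab_zero n a f hf
  | succ b ih =>
    intro a f hf
    rw [pow_succ, Module.End.mul_apply]
    exact ih _ _ (dD_mem n a b f hf)

theorem dE_nil (n a : ℕ) : ∀ (b : ℕ) (f) (_ : f ∈ Vab n a b),
    (((dE n).toLinearMap : Module.End ℂ _) ^ (a + 1)) f = 0 := by
  induction a with
  | zero => intro a f hf; simpa using dE_Vab_zero n a f hf
  | succ b ih =>
    intro a f hf
    rw [pow_succ, Module.End.mul_apply]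
    exact ih _ _ (dE_mem n b a f hf)

theorem dD_inj (n a b : ℕ) (hab : a < b) (f) (hf : f ∈ Vab n a b) (h0 : dD n f = 0) : f = 0 := by
  obtain ⟨c, rfl⟩ := Nat.exists_eq_add_of_lt hab
  refine sl2_inj (dE n).toLinearMap (dD n).toLinearMap (-(dH n).toLinearMap) ?_ ?_ c f ?_ h0 _
    (dE_nil n a _ f hf)
  · intro v
    simp [DE_comm]
  · intro v
    simp [HE_comm]
    ring
  · change -(dH n f) = _
    rw [dH_Vab n _ _ f hf, ← neg_smul]
    congr 1
    push_cast
    ring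

theorem dD_surj (n a b : ℕ) (hab : b ≤ a) (u) (hu : u ∈ Vab n (a + 1) b) :
    ∃ v ∈ Vab n a (b + 1), dD n v = u := by
  obtain ⟨c, rfl⟩ := Nat.exists_eq_add_of_le hab
  refine sl2_surj (dD n).toLinearMap (dE n).toLinearMap (dH n).toLinearMap ?_ ?_ c
    (Vab n (b + c + 1) b) (Vab n (b + c) (b + 1)) ?_ ?_ ?_ _ u hu (dD_nil n b _ u hu)
  · exact DE_comm n
  · exact HD_comm n
  · intro f hf
    change dH n f = _
    rw [dH_Vab n _ _ f hf]
    congr 1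
    push_cast
    ring
  · exact dE_mem n _ _
  · exact dD_mem n _ _

/-- Splitting of exponents of bidegree `(a, b)`. -/
noncomputable def expEquiv (n a b : ℕ) :
    {d : Fin (n + 1) ⊕ Fin (n + 1) →₀ ℕ | Finsupp.weight (wt n) d = (a, b)} ≃
      Sym (Fin (n + 1)) a × Sym (Fin (n + 1)) b where
  toFun d := ((Sym.equivNatSumOfFintype _ _).symm ⟨fun i => d.1 (Sum.inl i), by
      have := d.2; simp only [Set.mem_ofPred_eq, weight_wt, Prod.mk.injEq] at this; exact this.1⟩,
    (Sym.equivNatSumOfFintype _ _).symm ⟨fun i => d.1 (Sum.inr i), by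
      have := d.2; simp only [Set.mem_ofPred_eq, weight_wt, Prod.mk.injEq] at this; exact this.2⟩)
  invFun p := ⟨Finsupp.equivFunOnFinite.symm (Sum.elim (Sym.equivNatSumOfFintype _ _ p.1).1
      (Sym.equivNatSumOfFintype _ _ p.2).1), by
      simp only [Set.mem_ofPred_eq, weight_wt, Prod.mk.injEq, Finsupp.equivFunOnFinite_symm_apply_apply,
        Sum.elim_inl, Sum.elim_inr]
      exact ⟨(Sym.equivNatSumOfFintype _ _ p.1).2, (Sym.equivNatSumOfFintype _ _ p.2).2⟩⟩
  left_inv d := by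
    apply Subtype.ext
    ext i
    cases i <;> simp only [Equiv.apply_symm_apply, Finsupp.equivFunOnFinite_symm_apply_apply,
        Sum.elim_inl, Sum.elim_inr]
  right_inv p := by
    ext1 <;> rw [Equiv.symm_apply_eq] <;> rfl

theorem Vab_eq (n a b : ℕ) : Vab n a b =
    AddMonoidAlgebra.supported ℂ ℂ {d | Finsupp.weight (wt n) d = (a, b)} :=
  weightedHomogeneousSubmodule_eq_finsupp_supported ℂ (wt n) (a, b)

instance Vab_finite (n a b : ℕ) : Module.Finite ℂ (Vab n a b) := by
  rw [Vab_eq]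
  have : Finite {d | Finsupp.weight (wt n) d = (a, b)} := Finite.of_equiv _ (expEquiv n a b).symm
  exact Module.Finite.of_basis (basisRestrictSupport ℂ {d | Finsupp.weight (wt n) d = (a, b)})

theorem finrank_Vab (n a b : ℕ) :
    Module.finrank ℂ (Vab n a b) = (a + n).choose n * (b + n).choose n := by
  rw [Vab_eq]
  have h := Module.finrank_eq_nat_card_basis
    (basisRestrictSupport ℂ {d | Finsupp.weight (wt n) d = (a, b)})
  have e : ∀ c : ℕ, (Fintype.card (Fin (n + 1)) + c - 1).choose c = (c + n).choose n := by
    intro c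
    rw [Fintype.card_fin, show n + 1 + c - 1 = c + n by omega]
    exact Nat.choose_symm_add
  refine h.trans ?_
  rw [Nat.card_congr (expEquiv n a b), Nat.card_prod, Nat.card_eq_fintype_card,
    Nat.card_eq_fintype_card, Sym.card_sym_eq_choose, Sym.card_sym_eq_choose, e, e]

theorem choose_step (n a : ℕ) :
    ((a + 1 + n).choose n : ℝ) = (a + n).choose n * (1 + n / (a + 1)) := by
  have h := Nat.add_one_mul_choose_eq (a + n) a
  have h1 : (a + n).choose n = (a + n).choose a := Nat.choose_symm_add.symm
  have h2 : (a + 1 + n).choose n = (a + n + 1).choose (a + 1) := by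
    rw [show a + n + 1 = a + 1 + n by omega]; exact Nat.choose_symm_add.symm
  rw [h1, h2]
  have h3 : ((a : ℝ) + n + 1) * (a + n).choose a = (a + n + 1).choose (a + 1) * (a + 1) := by
    exact_mod_cast h
  have : (a : ℝ) + 1 ≠ 0 := by positivity
  field_simp
  linarith

theorem choose_le (n a : ℕ) : (a + n).choose n ≤ (a + 1) ^ n := by
  induction n with
  | zero => simp
  | succ n ih =>
    have h := Nat.add_one_mul_choose_eq (a + n) n
    have h2 : (a + n + 1).choose (n + 1) * (n + 1) ≤ (a + 1) ^ (n + 1) * (n + 1) := by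
      have : (a + n).succ * (a + n).choose n = (a + n + 1).choose (n + 1) * (n + 1) := h
      rw [← this, pow_succ]
      calc (a + n).succ * (a + n).choose n ≤ ((a + 1) * (n + 1)) * (a + 1) ^ n :=
            Nat.mul_le_mul (by simp only [Nat.succ_eq_add_one]; nlinarith) ih
        _ = _ := by ring
    exact Nat.le_of_mul_le_mul_right h2 (by omega)

theorem finrank_step (n a b K L : ℕ) (hn : 1 ≤ n) (h1 : a ≤ b + K) (h2 : b ≤ a + K)
    (ha : a + 1 ≤ L) (hb : b + 1 ≤ L) :
    |(Module.finrank ℂ (Vab n a (b + 1)) : ℝ) - Module.finrank ℂ (Vab n (a + 1) b)|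
      ≤ n * K * (L : ℝ) ^ (2 * n - 2) := by
  rw [finrank_Vab, finrank_Vab]
  push_cast
  rw [choose_step, choose_step]
  have ha0 : (0 : ℝ) < (a : ℝ) + 1 := by positivity
  have hb0 : (0 : ℝ) < (b : ℝ) + 1 := by positivity
  have hF : ∀ c : ℕ, c + 1 ≤ L → ((c + n).choose n : ℝ) / (c + 1) ≤ (L : ℝ) ^ (n - 1) := by
    intro c hc
    rw [div_le_iff₀ (by positivity)]
    calc ((c + n).choose n : ℝ) ≤ ((c : ℝ) + 1) ^ n := by exact_mod_cast choose_le n c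
      _ = ((c : ℝ) + 1) ^ (n - 1) * (c + 1) := by rw [← pow_succ, Nat.sub_add_cancel hn]
      _ ≤ _ := by
        gcongr
        exact_mod_cast hc
  have e : ((a + n).choose n : ℝ) * (((b + n).choose n : ℝ) * (1 + n / (b + 1))) -
      ((a + n).choose n : ℝ) * (1 + n / (a + 1)) * ((b + n).choose n : ℝ) =
      n * ((a : ℝ) - b) * ((((a + n).choose n : ℝ) / (a + 1)) * (((b + n).choose n : ℝ) / (b + 1))) := by
    field_simp
    ring
  rw [e, abs_mul, abs_mul, abs_of_nonneg (by positivity : (0 : ℝ) ≤ n)]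
  rw [abs_of_nonneg (by positivity : (0 : ℝ) ≤ (((a + n).choose n : ℝ) / (a + 1)) *
    (((b + n).choose n : ℝ) / (b + 1)))]
  have hK : |(a : ℝ) - b| ≤ K := by
    have h1' : (a : ℝ) ≤ b + K := by exact_mod_cast h1
    have h2' : (b : ℝ) ≤ a + K := by exact_mod_cast h2
    rw [abs_le]; constructor <;> linarith
  rw [show 2 * n - 2 = (n - 1) + (n - 1) by omega, pow_add]
  gcongr
  · exact hF a ha
  · exact hF b hb

theorem Dop_mem (n a b : ℕ) (f) (hf : f ∈ Vab n a (b + 1)) : Dop n f ∈ Vab n (a + 1) b := by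
  rw [Dop_eq]; exact dD_mem n a b f hf

theorem ker_step (n a b : ℕ) :
    (Module.finrank ℂ ↥(LinearMap.ker (Dop n) ⊓ Vab n a (b + 1)) : ℝ) ≤
    |(Module.finrank ℂ (Vab n a (b + 1)) : ℝ) - Module.finrank ℂ (Vab n (a + 1) b)| := by
  by_cases hab : a < b + 1
  · have : LinearMap.ker (Dop n) ⊓ Vab n a (b + 1) = ⊥ := by
      rw [eq_bot_iff]
      rintro f ⟨h1, h2⟩
      rw [SetLike.mem_coe, LinearMap.mem_ker, Dop_eq] at h1
      exact dD_inj n a (b + 1) hab f h2 h1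
    rw [this]
    simp
  · let φ : Vab n a (b + 1) →ₗ[ℂ] Vab n (a + 1) b := (Dop n).restrict (Dop_mem n a b)
    have hφ : Function.Surjective φ := by
      rintro ⟨u, hu⟩
      obtain ⟨v, hv, h⟩ := dD_surj n a b (by omega) u hu
      refine ⟨⟨v, hv⟩, Subtype.ext ?_⟩
      change Dop n v = u
      rw [Dop_eq, h]
    have hr := LinearMap.finrank_range_add_finrank_ker φ
    rw [LinearMap.range_eq_top.2 hφ, finrank_top] at hr
    have hle : Module.finrank ℂ ↥(LinearMap.ker (Dop n) ⊓ Vab n a (b + 1)) ≤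
        Module.finrank ℂ (LinearMap.ker φ) := by
      have : LinearMap.ker (Dop n) ⊓ Vab n a (b + 1) ≤
          (LinearMap.ker φ).map (Vab n a (b + 1)).subtype := by
        rintro f ⟨h1, h2⟩
        exact ⟨⟨f, h2⟩, Subtype.ext h1, rfl⟩
      exact (Submodule.finrank_mono this).trans (Submodule.finrank_map_le _ _)
    have : (Module.finrank ℂ ↥(LinearMap.ker (Dop n) ⊓ Vab n a (b + 1)) : ℝ) ≤
        Module.finrank ℂ (LinearMap.ker φ) := by exact_mod_cast hle
    refine this.trans (le_trans (le_of_eq ?_) (le_abs_self _))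
    rw [← hr]
    push_cast
    ring

theorem ker_pow_succ {W : Type*} [AddCommGroup W] [Module ℂ W] (D : Module.End ℂ W)
    (P Q : Submodule ℂ W) [Module.Finite ℂ P] [Module.Finite ℂ Q] (hPQ : ∀ v ∈ P, D v ∈ Q)
    (k : ℕ) :
    Module.finrank ℂ ↥(LinearMap.ker (D ^ (k + 1)) ⊓ P) ≤
      Module.finrank ℂ ↥(LinearMap.ker D ⊓ P) + Module.finrank ℂ ↥(LinearMap.ker (D ^ k) ⊓ Q) := by
  let R : Submodule ℂ W := LinearMap.ker (D ^ (k + 1)) ⊓ P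
  have hRP : R ≤ P := inf_le_right
  have : Module.Finite ℂ R := Submodule.finiteDimensional_of_le hRP
  have : Module.Finite ℂ ↥(LinearMap.ker D ⊓ P) :=
    Submodule.finiteDimensional_of_le (inf_le_right : _ ≤ P)
  have : Module.Finite ℂ ↥(LinearMap.ker (D ^ k) ⊓ Q) :=
    Submodule.finiteDimensional_of_le (inf_le_right : _ ≤ Q)
  have hr := LinearMap.finrank_range_add_finrank_ker (D.domRestrict R)
  have h1 : LinearMap.range (D.domRestrict R) ≤ LinearMap.ker (D ^ k) ⊓ Q := by
    rintro _ ⟨⟨v, hv⟩, rfl⟩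
    refine ⟨?_, hPQ v hv.2⟩
    have := hv.1
    rw [SetLike.mem_coe, LinearMap.mem_ker, pow_succ] at this
    exact this
  have h2 : (LinearMap.ker (D.domRestrict R)).map R.subtype ≤ LinearMap.ker D ⊓ P := by
    rintro _ ⟨⟨v, hv⟩, h, rfl⟩
    exact ⟨h, hv.2⟩
  have h3 := Submodule.finrank_mono h1
  have h4 := Submodule.finrank_mono h2
  rw [Submodule.finrank_map_subtype_eq] at h4
  change Module.finrank ℂ R ≤ _
  omega

theorem ker_pow_bound (n b : ℕ) (B : ℝ) (k : ℕ) : ∀ (p : ℕ)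
    (_ : ∀ a' b', p ≤ a' → a' + 1 ≤ p + k → b ≤ b' → b' + 1 ≤ b + k →
      |(Module.finrank ℂ (Vab n a' (b' + 1)) : ℝ) - Module.finrank ℂ (Vab n (a' + 1) b')| ≤ B),
    (Module.finrank ℂ ↥(LinearMap.ker (Dop n ^ k) ⊓ Vab n p (b + k)) : ℝ) ≤ k * B ∧
    |(Module.finrank ℂ (Vab n p (b + k)) : ℝ) - Module.finrank ℂ (Vab n (p + k) b)| ≤ k * B := by
  induction k with
  | zero =>
    intro p _
    have : LinearMap.ker (Dop n ^ 0) = ⊥ := by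
      rw [pow_zero]; exact LinearMap.ker_id
    rw [this]
    simp
  | succ k ih =>
    intro p h
    obtain ⟨i1, i2⟩ := ih (p + 1) (fun a' b' h1 h2 h3 h4 =>
      h a' b' (by omega) (by omega) (by omega) (by omega))
    have h0 := h p (b + k) (by omega) (by omega) (by omega) (by omega)
    have hk := ker_step n p (b + k)
    have hs := ker_pow_succ (Dop n) (Vab n p (b + k + 1)) (Vab n (p + 1) (b + k))
      (Dop_mem n p (b + k)) k
    have hs' : (Module.finrank ℂ ↥(LinearMap.ker (Dop n ^ (k + 1)) ⊓ Vab n p (b + k + 1)) : ℝ) ≤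
      Module.finrank ℂ ↥(LinearMap.ker (Dop n) ⊓ Vab n p (b + k + 1)) +
      Module.finrank ℂ ↥(LinearMap.ker (Dop n ^ k) ⊓ Vab n (p + 1) (b + k)) := by exact_mod_cast hs
    constructor
    · rw [← add_assoc b k 1]
      push_cast
      linarith
    · rw [← add_assoc b k 1, show p + (k + 1) = p + 1 + k by omega]
      have := abs_sub_le (Module.finrank ℂ (Vab n p (b + k + 1)) : ℝ)
        (Module.finrank ℂ (Vab n (p + 1) (b + k))) (Module.finrank ℂ (Vab n (p + 1 + k) b))
      push_cast
      linarith

theorem g_bound (n k p q r s : ℕ) (hr : p + k = r) (hq : s + k = q) (B : ℝ)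
    (h : ∀ a' b', p ≤ a' → a' + 1 ≤ p + k → s ≤ b' → b' + 1 ≤ s + k →
      |(Module.finrank ℂ (Vab n a' (b' + 1)) : ℝ) - Module.finrank ℂ (Vab n (a' + 1) b')| ≤ B)
    (g : Vab n p q →ₗ[ℂ] Vab n r s)
    (hg : ∀ v, (g v : MvPolynomial (Fin (n + 1) ⊕ Fin (n + 1)) ℂ)
            = ((Dop n) ^ k) (v : MvPolynomial (Fin (n + 1) ⊕ Fin (n + 1)) ℂ)) :
    (Module.finrank ℂ (LinearMap.ker g) : ℝ) ≤ k * B ∧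
    (Module.finrank ℂ (↥(Vab n r s) ⧸ LinearMap.range g) : ℝ) ≤ 2 * (k * B) := by
  subst hr hq
  obtain ⟨h1, h2⟩ := ker_pow_bound n s B k p h
  have hle : (LinearMap.ker g).map (Vab n p (s + k)).subtype ≤
      LinearMap.ker (Dop n ^ k) ⊓ Vab n p (s + k) := by
    rintro _ ⟨v, hv, rfl⟩
    refine ⟨?_, v.2⟩
    have hv' : g v = 0 := hv
    have := hg v
    rw [hv'] at this
    exact this.symm
  have : Module.Finite ℂ ↥(LinearMap.ker (Dop n ^ k) ⊓ Vab n p (s + k)) :=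
    Submodule.finiteDimensional_of_le (inf_le_right : _ ≤ Vab n p (s + k))
  have h3 := Submodule.finrank_mono hle
  rw [Submodule.finrank_map_subtype_eq] at h3
  have h3' : (Module.finrank ℂ (LinearMap.ker g) : ℝ) ≤
    Module.finrank ℂ ↥(LinearMap.ker (Dop n ^ k) ⊓ Vab n p (s + k)) := by exact_mod_cast h3
  have h4 := LinearMap.finrank_range_add_finrank_ker g
  have h5 := Submodule.finrank_quotient_add_finrank (LinearMap.range g)
  have h4' : (Module.finrank ℂ (LinearMap.range g) : ℝ) + Module.finrank ℂ (LinearMap.ker g) =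
    Module.finrank ℂ (Vab n p (s + k)) := by exact_mod_cast h4
  have h5' : (Module.finrank ℂ (↥(Vab n (p + k) s) ⧸ LinearMap.range g) : ℝ) +
    Module.finrank ℂ (LinearMap.range g) = Module.finrank ℂ (Vab n (p + k) s) := by
    exact_mod_cast h5
  have h6 := (abs_le.1 h2).1
  constructor <;> linarith

/-- For `a1 = a2 = a ≥ 1`, both the kernel and the cokernel of
`D^k : V_{m·a−k, m·a+k−(n+1)} → V_{m·a, m·a−(n+1)}` have dimension `O(m^{2n−2})`. -/
theorem kernel_cokernel_bound_of_a1_eq_a2 (n k a : ℕ)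
    (hn : 1 ≤ n) (hk : 1 ≤ k) (ha : 1 ≤ a) :
    ∃ C : ℝ, 0 < C ∧ ∃ M : ℕ, ∀ m : ℕ, M ≤ m → 0 < m →
      ∀ g : (Vab n (m * a - k) (m * a + k - (n + 1))) →ₗ[ℂ]
            (Vab n (m * a) (m * a - (n + 1))),
        (∀ v, (g v : MvPolynomial (Fin (n + 1) ⊕ Fin (n + 1)) ℂ)
            = ((Dop n) ^ k) (v : MvPolynomial (Fin (n + 1) ⊕ Fin (n + 1)) ℂ)) →
        (Module.finrank ℂ (LinearMap.ker g) : ℝ) ≤ C * (m : ℝ) ^ (2 * n - 2) ∧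
        (Module.finrank ℂ
            (↥(Vab n (m * a) (m * a - (n + 1))) ⧸ LinearMap.range g) : ℝ)
          ≤ C * (m : ℝ) ^ (2 * n - 2) := by
  refine ⟨2 * (k * (n * (2 * k + n + 1 : ℕ) * ((a + k + 1 : ℕ) : ℝ) ^ (2 * n - 2))), ?_,
    k + n + 1, ?_⟩
  · have : (0 : ℝ) < k := by exact_mod_cast hk
    have : (0 : ℝ) < n := by exact_mod_cast hn
    positivity
  intro m hM hm g hg
  have hma : m ≤ m * a := Nat.le_mul_of_pos_right m ha
  have hmk : k + 1 ≤ m * (k + 1) := Nat.le_mul_of_pos_left _ hm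
  have hmul : m * (a + k + 1) = m * a + m * (k + 1) := by ring
  obtain ⟨h1, h2⟩ := g_bound n k (m * a - k) (m * a + k - (n + 1)) (m * a) (m * a - (n + 1))
    (by omega) (by omega)
    (n * (2 * k + n + 1 : ℕ) * ((m * (a + k + 1) : ℕ) : ℝ) ^ (2 * n - 2))
    (fun a' b' e1 e2 e3 e4 => finrank_step n a' b' (2 * k + n + 1) (m * (a + k + 1)) hn
      (by omega) (by omega) (by omega) (by omega)) g hg
  have e : (2 : ℝ) * (k * (n * (2 * k + n + 1 : ℕ) * ((m * (a + k + 1) : ℕ) : ℝ) ^ (2 * n - 2))) =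
      2 * (k * (n * (2 * k + n + 1 : ℕ) * ((a + k + 1 : ℕ) : ℝ) ^ (2 * n - 2))) *
        (m : ℝ) ^ (2 * n - 2) := by
    rw [Nat.cast_mul m, mul_pow]
    ring
  rw [← e]
  refine ⟨h1.trans ?_, h2⟩
  have : (0 : ℝ) ≤ k * (n * (2 * k + n + 1 : ℕ) * ((m * (a + k + 1) : ℕ) : ℝ) ^ (2 * n - 2)) := by
    positivity
  linarith
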